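/- Let C₁,…,Cₙ be 2-copulas and suppose for some index j the copula Cⱼ generates an absolutely regular (β-mixing) stationary Markov chain. Then any stationary Markov chain generated by a convex combination ∑ₖ aₖCₖ with ∑ₖ aₖ = 1, aₖ ≥ 0 and aⱼ > 0 is absolutely regular. In particular, for any m ≥ 1, the m-step transition kernel of the chain generated by C = ∑ₖ aₖCₖ satisfies Pᵐ(x,A) ≥ aⱼᵐ · ∂₁Cⱼᵐ(x,A) for a.e. x and all Borel A ⊆ [0,1], so irreducibility and aperiodicity are inherited from Cⱼ. -/

import Mathlib

open MeasureTheory ProbabilityTheory Set Filter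

/-- A 2-copula on `[0,1]²`. -/
def IsCopula (C : ℝ → ℝ → ℝ) : Prop :=
  (∀ x ∈ Icc (0:ℝ) 1, C x 0 = 0) ∧
  (∀ y ∈ Icc (0:ℝ) 1, C 0 y = 0) ∧
  (∀ x ∈ Icc (0:ℝ) 1, C x 1 = x) ∧
  (∀ y ∈ Icc (0:ℝ) 1, C 1 y = y) ∧
  (∀ x₁ x₂ y₁ y₂ : ℝ, x₁ ∈ Icc (0:ℝ) 1 → x₂ ∈ Icc (0:ℝ) 1 → y₁ ∈ Icc (0:ℝ) 1 →
    y₂ ∈ Icc (0:ℝ) 1 → x₁ ≤ x₂ → y₁ ≤ y₂ →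
    0 ≤ C x₂ y₂ - C x₂ y₁ - C x₁ y₂ + C x₁ y₁)

/-- The fold product of two copulas:
`(C₁ ∗ C₂)(x,y) = ∫₀¹ ∂₂C₁(x,t) ∂₁C₂(t,y) dt`. -/
noncomputable def foldProd (C₁ C₂ : ℝ → ℝ → ℝ) : ℝ → ℝ → ℝ := fun x y =>
  ∫ t in (0:ℝ)..1, deriv (fun s => C₁ x s) t * deriv (fun s => C₂ s y) t

/-- The n-fold composition (n-step transition kernel) of a kernel. -/
noncomputable def kpow {α : Type*} [MeasurableSpace α] (κ : Kernel α α) : ℕ → Kernel α α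
  | 0 => Kernel.id
  | n + 1 => κ ∘ₖ kpow κ n

/-- The uniform (Lebesgue) probability measure on `[0,1]`. -/
noncomputable def unif01 : Measure ℝ := volume.restrict (Icc (0:ℝ) 1)

/-- `κ` is the transition kernel of the stationary Markov chain generated by the copula `C`
(with uniform marginals), i.e. `κ x [0,y] = ∂₁C(x,y)` for a.e. `x`. -/
def IsCopulaKernel (C : ℝ → ℝ → ℝ) (κ : Kernel ℝ ℝ) : Prop :=
  ∀ y ∈ Icc (0:ℝ) 1, ∀ᵐ x ∂unif01, κ x (Iic y) = ENNReal.ofReal (deriv (fun s => C s y) x)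

/-- The absolute regularity (β-mixing) coefficient of a transition kernel `κ` with respect to
the invariant measure `unif01`: `β = ∫ sup_B |κ(x,B) − λ(B)| dλ(x)`. -/
noncomputable def betaKernel (κ : Kernel ℝ ℝ) : ℝ :=
  ∫ x, (⨆ B : {s : Set ℝ // MeasurableSet s}, |(κ x (B : Set ℝ)).toReal - (unif01 (B : Set ℝ)).toReal|) ∂unif01


lemma aux_le_of_cdf (μ ν : Measure ℝ) [IsProbabilityMeasure μ] [IsProbabilityMeasure ν] (a : ℝ)
    (ha : 0 ≤ a)
    (h : ∀ p q : ℚ, p ≤ q → cdf μ p - a * cdf ν p ≤ cdf μ q - a * cdf ν q) :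
    ENNReal.ofReal a • ν ≤ μ := by
  have hrc : ∀ x, ContinuousWithinAt (fun y => cdf μ y - a * cdf ν y) (Ici x) x := fun x =>
    ((cdf μ).right_continuous x).sub (((cdf ν).right_continuous x).const_mul a)
  have hfreq : ∀ x y : ℝ, x < y → ∃ᶠ z in nhdsWithin x (Ioi x), (∃ q : ℚ, (q : ℝ) = z) ∧ z < y := by
    intro x y hxy
    rw [frequently_iff]
    intro U hU
    rw [mem_nhdsGT_iff_exists_Ioo_subset] at hU
    obtain ⟨u, hu, hsub⟩ := hU
    obtain ⟨q, hq1, hq2⟩ := exists_rat_btwn (lt_min hu hxy)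
    exact ⟨q, hsub ⟨hq1, hq2.trans_le (min_le_left _ _)⟩, ⟨q, rfl⟩, hq2.trans_le (min_le_right _ _)⟩
  have hlim : ∀ x, Tendsto (fun y => cdf μ y - a * cdf ν y) (nhdsWithin x (Ioi x))
      (nhds (cdf μ x - a * cdf ν x)) := fun x =>
    (hrc x).tendsto.mono_left (nhdsWithin_mono _ Ioi_subset_Ici_self)
  have h1 : ∀ (x : ℝ) (q : ℚ), x < q → cdf μ x - a * cdf ν x ≤ cdf μ q - a * cdf ν q := by
    intro x q hxq
    refine le_of_tendsto_of_frequently (hlim x) ((hfreq x q hxq).mono ?_)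
    rintro z ⟨⟨r, rfl⟩, hz⟩
    exact h r q (by exact_mod_cast hz.le)
  have hmono : Monotone (fun y => cdf μ y - a * cdf ν y) := by
    intro x y hxy
    refine ge_of_tendsto_of_frequently (hlim y) ((hfreq y (y+1) (by linarith)).and_eventually
      self_mem_nhdsWithin |>.mono ?_)
    rintro z ⟨⟨⟨r, rfl⟩, hz⟩, hz'⟩
    exact h1 x r (lt_of_le_of_lt hxy hz')
  let F : StieltjesFunction ℝ := ⟨fun y => cdf μ y - a * cdf ν y, hmono, hrc⟩
  have hF0 : Tendsto F atBot (nhds 0) := by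
    have := (tendsto_cdf_atBot μ).sub ((tendsto_cdf_atBot ν).const_mul a)
    simpa using this
  have hF1 : Tendsto F atTop (nhds (1 - a)) := by
    have := (tendsto_cdf_atTop μ).sub ((tendsto_cdf_atTop ν).const_mul a)
    simpa using this
  have hFfin : IsFiniteMeasure F.measure := ⟨by rw [F.measure_univ hF0 hF1]; simp⟩
  have : IsFiniteMeasure (ENNReal.ofReal a • ν) := ⟨by simp⟩
  have heq : F.measure + ENNReal.ofReal a • ν = μ := by
    refine Measure.ext_of_Iic _ _ fun y => ?_
    have hFy : 0 ≤ F y := hmono.le_of_tendsto hF0 y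
    rw [Measure.add_apply, F.measure_Iic hF0, Measure.smul_apply, ← ofReal_cdf, ← ofReal_cdf,
      smul_eq_mul, ← ENNReal.ofReal_mul ha, sub_zero, ← ENNReal.ofReal_add hFy
        (mul_nonneg ha (cdf_nonneg _ _))]
    congr 1
    change cdf μ y - a * cdf ν y + _ = _
    ring
  rw [← heq]
  exact Measure.le_add_left le_rfl

instance : IsProbabilityMeasure unif01 := ⟨by simp [unif01]⟩

lemma aux_ae_Ioo : ∀ᵐ x ∂unif01, x ∈ Ioo (0:ℝ) 1 := by
  rw [unif01, ← restrict_Ioo_eq_restrict_Icc]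
  exact ae_restrict_mem measurableSet_Ioo

lemma aux_mono_diff {C : ℝ → ℝ → ℝ} (hC : IsCopula C) {y₁ y₂ : ℝ} (h1 : y₁ ∈ Icc (0:ℝ) 1)
    (h2 : y₂ ∈ Icc (0:ℝ) 1) (h : y₁ ≤ y₂) :
    MonotoneOn (fun s => C s y₂ - C s y₁) (Icc 0 1) := by
  intro s hs t ht hst
  have := hC.2.2.2.2 s t y₁ y₂ hs ht h1 h2 hst h
  dsimp only
  linarith

lemma aux_mono {C : ℝ → ℝ → ℝ} (hC : IsCopula C) {y : ℝ} (h1 : y ∈ Icc (0:ℝ) 1) :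
    MonotoneOn (fun s => C s y) (Icc 0 1) := by
  intro s hs t ht hst
  have := aux_mono_diff hC (y₁ := 0) (by simp) h1 h1.1 hs ht hst
  simpa [hC.1 s hs, hC.1 t ht] using this

lemma aux_lip {C : ℝ → ℝ → ℝ} (hC : IsCopula C) {y : ℝ} (h1 : y ∈ Icc (0:ℝ) 1) :
    LipschitzOnWith 1 (fun s => C s y) (Icc 0 1) := by
  apply LipschitzOnWith.of_le_add_mul
  intro t ht s hs
  rcases le_total s t with hst | hst
  · have := aux_mono_diff hC (y₂ := 1) h1 (by simp) h1.2 hs ht hst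
    simp only [hC.2.2.1 s hs, hC.2.2.1 t ht] at this
    rw [Real.dist_eq, abs_of_nonneg (by linarith)]
    simp; linarith
  · have := aux_mono hC h1 ht hs hst
    simp only at this
    have := dist_nonneg (x := t) (y := s)
    simp; linarith

lemma aux_deriv_nonneg {f : ℝ → ℝ} (hf : MonotoneOn f (Icc 0 1)) {x : ℝ} (hx : x ∈ Ioo (0:ℝ) 1) :
    0 ≤ deriv f x := by
  have : Icc (0:ℝ) 1 ∈ nhds x := Icc_mem_nhds hx.1 hx.2
  rw [← derivWithin_of_mem_nhds this]
  exact hf.derivWithin_nonneg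

lemma aux_ae_diff {f : ℝ → ℝ} (hf : MonotoneOn f (Icc 0 1)) :
    ∀ᵐ x ∂unif01, DifferentiableAt ℝ f x := by
  have := hf.ae_differentiableWithinAt measurableSet_Icc
  filter_upwards [aux_ae_Ioo, this] with x hx h
  exact h.differentiableAt (Icc_mem_nhds hx.1 hx.2)

lemma aux_deriv_zero {C : ℝ → ℝ → ℝ} (hC : IsCopula C) {x : ℝ} (hx : x ∈ Ioo (0:ℝ) 1) :
    deriv (fun s => C s 0) x = 0 := by
  have : (fun s => C s 0) =ᶠ[nhds x] fun _ => 0 := by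
    filter_upwards [Icc_mem_nhds hx.1 hx.2] with s hs using hC.1 s hs
  rw [this.deriv_eq]; simp

lemma aux_deriv_one {C : ℝ → ℝ → ℝ} (hC : IsCopula C) {x : ℝ} (hx : x ∈ Ioo (0:ℝ) 1) :
    deriv (fun s => C s 1) x = 1 := by
  have : (fun s => C s 1) =ᶠ[nhds x] fun s => s := by
    filter_upwards [Icc_mem_nhds hx.1 hx.2] with s hs using hC.2.2.1 s hs
  rw [this.deriv_eq]; simp

/-- clamp to the unit interval -/
noncomputable def auxClamp (y : ℝ) : ℝ := max 0 (min y 1)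

lemma auxClamp_mem (y : ℝ) : auxClamp y ∈ Icc (0:ℝ) 1 := by
  simp [auxClamp]

lemma auxClamp_mono : Monotone auxClamp := fun x y h => by
  unfold auxClamp; gcongr

/-- the cdf of a copula kernel -/
lemma aux_kernel_cdf {C : ℝ → ℝ → ℝ} (hC : IsCopula C) {κ : Kernel ℝ ℝ} [IsMarkovKernel κ]
    (hκ : IsCopulaKernel C κ) (y : ℝ) :
    ∀ᵐ x ∂unif01, cdf (κ x) y = deriv (fun s => C s (auxClamp y)) x := by
  filter_upwards [aux_ae_Ioo, hκ 0 (by simp), hκ 1 (by simp), hκ _ (auxClamp_mem y)]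
    with x hx h0 h1 hy
  have key : ∀ z ∈ Icc (0:ℝ) 1, κ x (Iic z) = ENNReal.ofReal (deriv (fun s => C s z) x) →
      cdf (κ x) z = deriv (fun s => C s z) x := by
    intro z hz h
    rw [cdf_eq_real, measureReal_def, h, ENNReal.toReal_ofReal (aux_deriv_nonneg (aux_mono hC hz) hx)]
  have k0 := key 0 (by simp) h0
  have k1 := key 1 (by simp) h1
  have ky := key _ (auxClamp_mem y) hy
  rw [aux_deriv_zero hC hx] at k0
  rw [aux_deriv_one hC hx] at k1
  rw [← ky]
  rcases lt_or_ge y 0 with h | h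
  · have e : auxClamp y = 0 := by
      simp [auxClamp, h.le]
    rw [e, k0]
    exact le_antisymm (k0 ▸ monotone_cdf _ h.le) (cdf_nonneg _ _)
  rcases lt_or_ge 1 y with h' | h'
  · have e : auxClamp y = 1 := by
      simp [auxClamp, h'.le]
    rw [e, k1]
    exact le_antisymm (cdf_le_one _ _) (k1 ▸ monotone_cdf _ h'.le)
  · have e : auxClamp y = y := by
      simp [auxClamp, h, h']
    rw [e]

lemma aux_unif_cdf (y : ℝ) : unif01 (Iic y) = ENNReal.ofReal (auxClamp y) := by
  rw [unif01, Measure.restrict_apply measurableSet_Iic]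
  have : Iic y ∩ Icc (0:ℝ) 1 = Icc 0 (min y 1) := by
    ext z; simp; tauto
  rw [this, Real.volume_Icc]
  simp [auxClamp, ENNReal.ofReal_max]

lemma aux_invariant {C : ℝ → ℝ → ℝ} (hC : IsCopula C) {κ : Kernel ℝ ℝ} [IsMarkovKernel κ]
    (hκ : IsCopulaKernel C κ) : unif01.bind κ = unif01 := by
  refine Measure.ext_of_Iic _ _ fun y => ?_
  rw [Measure.bind_apply measurableSet_Iic κ.measurable.aemeasurable, aux_unif_cdf]
  have hm := auxClamp_mem y
  have hac : AbsolutelyContinuousOnInterval (fun s => C s (auxClamp y)) 0 1 :=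
    LipschitzOnWith.absolutelyContinuousOnInterval (K := 1)
      (by rw [uIcc_of_le zero_le_one]; exact aux_lip hC hm)
  have h1 := hac.integral_deriv_eq_sub
  have hint := hac.intervalIntegrable_deriv
  rw [intervalIntegral.integral_of_le zero_le_one] at h1
  rw [intervalIntegrable_iff_integrableOn_Ioc_of_le zero_le_one] at hint
  have hu : unif01 = volume.restrict (Ioc (0:ℝ) 1) := by
    rw [unif01, restrict_Ioc_eq_restrict_Icc]
  have hint' : Integrable (deriv (fun s => C s (auxClamp y))) unif01 := by rw [hu]; exact hint
  have : ∫⁻ x, κ x (Iic y) ∂unif01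
      = ∫⁻ x, ENNReal.ofReal (deriv (fun s => C s (auxClamp y)) x) ∂unif01 := by
    refine lintegral_congr_ae ?_
    filter_upwards [aux_kernel_cdf hC hκ y] with x hx
    rw [← hx, ofReal_cdf]
  rw [this, ← ofReal_integral_eq_lintegral_ofReal hint', hu, h1, hC.2.2.2.1 _ hm, hC.2.1 _ hm,
    sub_zero]
  filter_upwards [aux_ae_Ioo] with x hx
  exact aux_deriv_nonneg (aux_mono hC hm) hx

lemma aux_copula_comb {N : ℕ} {C : Fin N → ℝ → ℝ → ℝ}
    (hC : ∀ k, IsCopula (C k)) {a : Fin N → ℝ} (ha : ∀ k, 0 ≤ a k)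
    (hsum : ∑ k, a k = 1) : IsCopula (fun x y => ∑ k, a k * C k x y) := by
  refine ⟨fun x hx => ?_, fun y hy => ?_, fun x hx => ?_, fun y hy => ?_, ?_⟩
  · exact Finset.sum_eq_zero fun k _ => by rw [(hC k).1 x hx, mul_zero]
  · exact Finset.sum_eq_zero fun k _ => by rw [(hC k).2.1 y hy, mul_zero]
  · simp_rw [fun k => (hC k).2.2.1 x hx, ← Finset.sum_mul, hsum, one_mul]
  · simp_rw [fun k => (hC k).2.2.2.1 y hy, ← Finset.sum_mul, hsum, one_mul]
  · intro x₁ x₂ y₁ y₂ h1 h2 h3 h4 h5 h6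
    rw [← Finset.sum_sub_distrib, ← Finset.sum_sub_distrib, ← Finset.sum_add_distrib]
    refine Finset.sum_nonneg fun k _ => ?_
    have := mul_nonneg (ha k) ((hC k).2.2.2.2 x₁ x₂ y₁ y₂ h1 h2 h3 h4 h5 h6)
    linarith

lemma aux_dom_one {N : ℕ} {C : Fin N → ℝ → ℝ → ℝ}
    (hC : ∀ k, IsCopula (C k)) {a : Fin N → ℝ} (ha : ∀ k, 0 ≤ a k)
    (hsum : ∑ k, a k = 1) (j : Fin N)
    (κj : Kernel ℝ ℝ) [IsMarkovKernel κj] (hκj : IsCopulaKernel (C j) κj)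
    (κ : Kernel ℝ ℝ) [IsMarkovKernel κ]
    (hκ : IsCopulaKernel (fun x y => ∑ k, a k * C k x y) κ) :
    ∀ᵐ x ∂unif01, ENNReal.ofReal (a j) • κj x ≤ κ x := by
  have hD : ∀ᵐ x ∂unif01, ∀ (q : ℚ) (k : Fin N),
      DifferentiableAt ℝ (fun s => C k s (auxClamp q)) x := by
    rw [ae_all_iff]; intro q
    rw [ae_all_iff]; intro k
    exact aux_ae_diff (aux_mono (hC k) (auxClamp_mem _))
  have h1 : ∀ᵐ x ∂unif01, ∀ q : ℚ, cdf (κj x) q = deriv (fun s => C j s (auxClamp q)) x := by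
    rw [ae_all_iff]; intro q
    exact aux_kernel_cdf (hC j) hκj q
  have h2 : ∀ᵐ x ∂unif01, ∀ q : ℚ,
      cdf (κ x) q = deriv (fun s => ∑ k, a k * C k s (auxClamp q)) x := by
    rw [ae_all_iff]; intro q
    exact aux_kernel_cdf (aux_copula_comb hC ha hsum) hκ q
  filter_upwards [hD, h1, h2, aux_ae_Ioo] with x hD h1 h2 hx
  refine aux_le_of_cdf _ _ _ (ha j) fun p q hpq => ?_
  have h3 : ∀ q : ℚ, cdf (κ x) q = ∑ k, a k * deriv (fun s => C k s (auxClamp q)) x := by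
    intro q
    rw [h2, deriv_fun_sum (fun k _ => (hD q k).const_mul _)]
    exact Finset.sum_congr rfl fun k _ => deriv_const_mul _ (hD q k)
  have h4 : ∀ k, deriv (fun s => C k s (auxClamp p)) x ≤ deriv (fun s => C k s (auxClamp q)) x := by
    intro k
    have := aux_deriv_nonneg (aux_mono_diff (hC k) (auxClamp_mem p) (auxClamp_mem q)
      (auxClamp_mono (by exact_mod_cast hpq))) hx
    rw [deriv_fun_sub (hD q k) (hD p k)] at this
    linarith
  rw [h3, h3, h1, h1, ← Finset.add_sum_erase _ _ (Finset.mem_univ j),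
    ← Finset.add_sum_erase _ _ (Finset.mem_univ j)]
  have := Finset.sum_le_sum (s := Finset.univ.erase j)
    fun k _ => mul_le_mul_of_nonneg_left (h4 k) (ha k)
  linarith

/-- total variation distance to the uniform measure -/
noncomputable def auxTV (μ : Measure ℝ) : ℝ :=
  ⨆ B : {s : Set ℝ // MeasurableSet s}, |(μ (B : Set ℝ)).toReal - (unif01 (B : Set ℝ)).toReal|

lemma aux_abs_le_one (μ : Measure ℝ) [IsProbabilityMeasure μ] (B : Set ℝ) :
    |(μ B).toReal - (unif01 B).toReal| ≤ 1 := by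
  have h1 : (μ B).toReal ≤ 1 := measureReal_le_one (μ := μ) (s := B)
  have h2 : (unif01 B).toReal ≤ 1 := measureReal_le_one (μ := unif01) (s := B)
  have h3 : 0 ≤ (μ B).toReal := ENNReal.toReal_nonneg
  have h4 : 0 ≤ (unif01 B).toReal := ENNReal.toReal_nonneg
  rw [abs_le]; constructor <;> linarith

lemma aux_le_tv (μ : Measure ℝ) [IsProbabilityMeasure μ] {B : Set ℝ} (hB : MeasurableSet B) :
    |(μ B).toReal - (unif01 B).toReal| ≤ auxTV μ :=
  le_ciSup (f := fun B : {s : Set ℝ // MeasurableSet s} =>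
    |(μ (B : Set ℝ)).toReal - (unif01 (B : Set ℝ)).toReal|)
    ⟨1, by rintro _ ⟨B, rfl⟩; exact aux_abs_le_one μ B⟩ ⟨B, hB⟩

lemma aux_tv_le {μ : Measure ℝ} {c : ℝ}
    (h : ∀ B, MeasurableSet B → |(μ B).toReal - (unif01 B).toReal| ≤ c) : auxTV μ ≤ c := by
  have : Nonempty {s : Set ℝ // MeasurableSet s} := ⟨⟨∅, MeasurableSet.empty⟩⟩
  exact ciSup_le fun B => h B B.2

lemma aux_tv_le_one (μ : Measure ℝ) [IsProbabilityMeasure μ] : auxTV μ ≤ 1 :=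
  aux_tv_le fun B _ => aux_abs_le_one μ B

lemma aux_tv_nonneg (μ : Measure ℝ) : 0 ≤ auxTV μ :=
  Real.iSup_nonneg fun _ => abs_nonneg _

lemma aux_symmDiff (μ : Measure ℝ) [IsFiniteMeasure μ] (s t : Set ℝ) :
    |(μ s).toReal - (μ t).toReal| ≤ (μ (symmDiff s t)).toReal := by
  have h1 : (μ s).toReal ≤ (μ t).toReal + (μ (symmDiff s t)).toReal := by
    refine (measureReal_mono (μ := μ) (s₂ := t ∪ symmDiff s t) ?_).trans (measureReal_union_le _ _)
    intro x hx
    by_cases h : x ∈ t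
    · exact Or.inl h
    · exact Or.inr (Or.inl ⟨hx, h⟩)
  have h2 : (μ t).toReal ≤ (μ s).toReal + (μ (symmDiff s t)).toReal := by
    refine (measureReal_mono (μ := μ) (s₂ := s ∪ symmDiff s t) ?_).trans (measureReal_union_le _ _)
    intro x hx
    by_cases h : x ∈ s
    · exact Or.inl h
    · exact Or.inr (Or.inr ⟨hx, h⟩)
  rw [abs_le]; constructor <;> linarith

lemma aux_tv_measurable (η : Kernel ℝ ℝ) [IsMarkovKernel η] : Measurable fun x => auxTV (η x) := by
  let 𝒜 : Set (Set ℝ) := generateSetAlgebra (MeasurableSpace.countableGeneratingSet ℝ)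
  have hcount : 𝒜.Countable :=
    countable_generateSetAlgebra (MeasurableSpace.countable_countableGeneratingSet (α := ℝ))
  have hgen : (inferInstance : MeasurableSpace ℝ) = MeasurableSpace.generateFrom 𝒜 := by
    rw [generateFrom_generateSetAlgebra_eq, MeasurableSpace.generateFrom_countableGeneratingSet]
  have hmeas : ∀ s ∈ 𝒜, MeasurableSet s := fun s hs => by
    have h := MeasurableSpace.measurableSet_generateFrom hs
    rw [← hgen] at h; exact h
  have hct : Countable 𝒜 := hcount.to_subtype
  have hne : Nonempty 𝒜 := ⟨⟨∅, isSetAlgebra_generateSetAlgebra.empty_mem⟩⟩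
  have heq : (fun x => auxTV (η x)) = fun x => ⨆ B : 𝒜,
      |(η x (B : Set ℝ)).toReal - (unif01 (B : Set ℝ)).toReal| := by
    funext x
    have hbdd : BddAbove (range fun B : 𝒜 =>
      |(η x (B : Set ℝ)).toReal - (unif01 (B : Set ℝ)).toReal|) :=
      ⟨1, by rintro _ ⟨B, rfl⟩; exact aux_abs_le_one _ B⟩
    apply le_antisymm
    · refine aux_tv_le fun B hB => le_of_forall_pos_le_add fun ε hε => ?_
      have hd := Measure.MeasureDense.of_generateFrom_isSetAlgebra_finite (η x + unif01)
        (𝒜 := 𝒜) isSetAlgebra_generateSetAlgebra hgen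
      obtain ⟨t, ht, hlt⟩ := hd.approx B hB (measure_ne_top _ _) ε hε
      have h1 := le_ciSup hbdd ⟨t, ht⟩
      have h2 := aux_symmDiff (η x) B t
      have h3 := aux_symmDiff unif01 B t
      have h4 : (η x (symmDiff B t)).toReal + (unif01 (symmDiff B t)).toReal < ε := by
        rw [← ENNReal.toReal_add (measure_ne_top _ _) (measure_ne_top _ _)]
        rw [Measure.add_apply] at hlt
        exact ENNReal.toReal_lt_of_lt_ofReal hlt
      dsimp only at h1
      rw [abs_le] at *
      constructor <;> linarith [h1.1, h1.2, h2.1, h2.2, h3.1, h3.2]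
    · exact ciSup_le fun B => aux_le_tv (η x) (hmeas B B.2)
  rw [heq]
  refine Measurable.iSup fun B => ?_
  have := (η.measurable_coe (hmeas B B.2)).ennreal_toReal
  fun_prop

lemma aux_tv_integrable (η : Kernel ℝ ℝ) [IsMarkovKernel η] (μ : Measure ℝ) [IsFiniteMeasure μ] :
    Integrable (fun x => auxTV (η x)) μ :=
  Integrable.of_bound (aux_tv_measurable η).aestronglyMeasurable 1 (ae_of_all _ fun x => by
    rw [Real.norm_eq_abs, abs_of_nonneg (aux_tv_nonneg _)]; exact aux_tv_le_one _)

lemma aux_integral_one_side (μ ν : Measure ℝ) [IsProbabilityMeasure μ] [IsProbabilityMeasure ν]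
    {f : ℝ → ℝ} (hf : Measurable f) {M : ℝ} (hfμ : ∀ᵐ x ∂μ, f x ∈ Icc 0 M)
    (hfν : ∀ᵐ x ∂ν, f x ∈ Icc 0 M) :
    ∃ s, MeasurableSet s ∧ ∫ x, f x ∂μ - ∫ x, f x ∂ν ≤ M * ((μ s).toReal - (ν s).toReal) := by
  obtain ⟨s, hs, h1, h2⟩ := hahn_decomposition μ ν
  refine ⟨s, hs, ?_⟩
  have iμ : Integrable f μ := Integrable.of_bound hf.aestronglyMeasurable M (by
    filter_upwards [hfμ] with x hx
    rw [Real.norm_eq_abs, abs_of_nonneg hx.1]; exact hx.2)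
  have iν : Integrable f ν := Integrable.of_bound hf.aestronglyMeasurable M (by
    filter_upwards [hfν] with x hx
    rw [Real.norm_eq_abs, abs_of_nonneg hx.1]; exact hx.2)
  have l1 : ν.restrict s ≤ μ.restrict s := by
    refine Measure.le_iff.2 fun t ht => ?_
    rw [Measure.restrict_apply ht, Measure.restrict_apply ht]
    exact h1 _ (ht.inter hs) inter_subset_right
  have l2 : μ.restrict sᶜ ≤ ν.restrict sᶜ := by
    refine Measure.le_iff.2 fun t ht => ?_
    rw [Measure.restrict_apply ht, Measure.restrict_apply ht]
    exact h2 _ (ht.inter hs.compl) inter_subset_right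
  have e2 : ∫ x in sᶜ, f x ∂μ ≤ ∫ x in sᶜ, f x ∂ν :=
    integral_mono_measure l2 ((ae_restrict_of_ae hfν).mono fun x hx => hx.1) iν.integrableOn
  have e1 : ∫ x in s, (M - f x) ∂ν ≤ ∫ x in s, (M - f x) ∂μ :=
    integral_mono_measure l1 ((ae_restrict_of_ae hfμ).mono fun x hx => sub_nonneg.2 hx.2)
      ((integrable_const M).sub iμ).integrableOn
  rw [integral_sub (integrable_const _) iμ.integrableOn,
    integral_sub (integrable_const _) iν.integrableOn] at e1
  simp only [integral_const, smul_eq_mul, measureReal_def, Measure.restrict_apply_univ] at e1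
  rw [← integral_add_compl hs iμ, ← integral_add_compl hs iν]
  linarith

lemma aux_integral_tv (μ : Measure ℝ) [IsProbabilityMeasure μ]
    {f : ℝ → ℝ} (hf : Measurable f) {M : ℝ} (hM : 0 ≤ M) (hfμ : ∀ᵐ x ∂μ, f x ∈ Icc 0 M)
    (hfν : ∀ᵐ x ∂unif01, f x ∈ Icc 0 M) :
    |∫ x, f x ∂μ - ∫ x, f x ∂unif01| ≤ M * auxTV μ := by
  obtain ⟨s, hs, h1⟩ := aux_integral_one_side μ unif01 hf hfμ hfν
  obtain ⟨t, ht, h2⟩ := aux_integral_one_side unif01 μ hf hfν hfμ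
  have h3 := mul_le_mul_of_nonneg_left ((le_abs_self _).trans (aux_le_tv μ hs)) hM
  have h4 := mul_le_mul_of_nonneg_left ((neg_le_abs _).trans (aux_le_tv μ ht)) hM
  rw [abs_le]; constructor <;> linarith

instance aux_kpow_markov (κ : Kernel ℝ ℝ) [IsMarkovKernel κ] (n : ℕ) : IsMarkovKernel (kpow κ n) := by
  induction n with
  | zero => rw [kpow]; infer_instance
  | succ n ih => rw [kpow]; infer_instance

lemma aux_kpow_add (κ : Kernel ℝ ℝ) (n m : ℕ) : kpow κ (n + m) = kpow κ m ∘ₖ kpow κ n := by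
  induction m with
  | zero => simp [kpow, Kernel.id_comp]
  | succ m ih => rw [← add_assoc, kpow, ih, kpow, Kernel.comp_assoc]

lemma aux_kpow_inv {κ : Kernel ℝ ℝ} (h : unif01.bind κ = unif01) (n : ℕ) :
    unif01.bind (kpow κ n) = unif01 := by
  induction n with
  | zero => simp [kpow]
  | succ n ih => rw [kpow, ← Measure.comp_assoc, ih, h]

lemma aux_ae_kernel {κ : Kernel ℝ ℝ} (h : unif01.bind κ = unif01) {p : ℝ → Prop}
    (hp : ∀ᵐ x ∂unif01, p x) : ∀ᵐ x ∂unif01, ∀ᵐ u ∂(κ x), p u := by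
  rw [← h] at hp
  exact Measure.ae_ae_of_ae_comp hp

lemma aux_integral_inv {κ : Kernel ℝ ℝ} [IsMarkovKernel κ] (h : unif01.bind κ = unif01) {f : ℝ → ℝ}
    (hf : Integrable f unif01) : ∫ x, ∫ u, f u ∂(κ x) ∂unif01 = ∫ x, f x ∂unif01 := by
  have e : unif01 = (κ ∘ₖ Kernel.const Unit unif01) () := by
    rw [← Measure.comp_eq_comp_const_apply, h]
  conv_rhs => rw [e]
  rw [Kernel.integral_comp (by rw [← e]; exact hf)]
  simp

lemma aux_dom_pow {κj κ : Kernel ℝ ℝ} [IsMarkovKernel κj] [IsMarkovKernel κ] {a : ℝ} (ha : 0 ≤ a)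
    (hj : unif01.bind κj = unif01)
    (hdom : ∀ᵐ x ∂unif01, ENNReal.ofReal a • κj x ≤ κ x) (m : ℕ) :
    ∀ᵐ x ∂unif01, ENNReal.ofReal (a ^ m) • kpow κj m x ≤ kpow κ m x := by
  induction m with
  | zero => simp [kpow]
  | succ m ih =>
    filter_upwards [ih, aux_ae_kernel (aux_kpow_inv hj m) hdom] with x h1 h2
    refine Measure.le_iff.2 fun A hA => ?_
    rw [kpow, kpow, Measure.smul_apply, Kernel.comp_apply' _ _ _ hA, Kernel.comp_apply' _ _ _ hA,
      smul_eq_mul, pow_succ, ENNReal.ofReal_mul (pow_nonneg ha m), mul_assoc,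
      ← lintegral_const_mul _ (κj.measurable_coe hA)]
    calc _ ≤ ENNReal.ofReal (a ^ m) * ∫⁻ u, κ u A ∂(kpow κj m x) := by
          gcongr 1
          refine lintegral_mono_ae ?_
          filter_upwards [h2] with u hu
          simpa using hu A
      _ = ∫⁻ u, κ u A ∂(ENNReal.ofReal (a ^ m) • kpow κj m x) := by
          rw [lintegral_smul_measure, smul_eq_mul]
      _ ≤ _ := lintegral_mono' h1 le_rfl

lemma aux_integral_apply {κ η : Kernel ℝ ℝ} [IsMarkovKernel κ] [IsMarkovKernel η] (x : ℝ)
    {B : Set ℝ} (hB : MeasurableSet B) :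
    ((κ ∘ₖ η) x B).toReal = ∫ u, (κ u B).toReal ∂(η x) := by
  rw [Kernel.comp_apply' _ _ _ hB, integral_toReal (κ.measurable_coe hB).aemeasurable
    (ae_of_all _ fun u => measure_lt_top _ _)]

lemma aux_integral_unif {κ : Kernel ℝ ℝ} [IsMarkovKernel κ] (h : unif01.bind κ = unif01)
    {B : Set ℝ} (hB : MeasurableSet B) :
    (unif01 B).toReal = ∫ u, (κ u B).toReal ∂unif01 := by
  rw [integral_toReal (κ.measurable_coe hB).aemeasurable
    (ae_of_all _ fun u => measure_lt_top _ _), ← Measure.bind_apply hB κ.aemeasurable, h]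

lemma aux_step {η P Q : Kernel ℝ ℝ} [IsMarkovKernel η] [IsMarkovKernel P] [IsMarkovKernel Q]
    {c : ℝ} (hc : 0 ≤ c) (hc1 : c ≤ 1) (hη : unif01.bind η = unif01) (hP : unif01.bind P = unif01)
    (hQ : unif01.bind Q = unif01)
    (hdom : ∀ᵐ x ∂unif01, ENNReal.ofReal c • Q x ≤ P x) :
    betaKernel (P ∘ₖ η) ≤ c * betaKernel Q + (1 - c) * betaKernel η := by
  have key : ∀ᵐ x ∂unif01, auxTV ((P ∘ₖ η) x) ≤
      c * (∫ u, auxTV (Q u) ∂(η x)) + (1 - c) * auxTV (η x) := by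
    filter_upwards [aux_ae_kernel hη hdom] with x hx
    refine aux_tv_le fun B hB => ?_
    have mP := (P.measurable_coe hB).ennreal_toReal
    have mQ := (Q.measurable_coe hB).ennreal_toReal
    have iK : ∀ (K : Kernel ℝ ℝ) [IsMarkovKernel K] (μ : Measure ℝ) [IsProbabilityMeasure μ],
        Integrable (fun u => (K u B).toReal) μ := fun K _ μ _ =>
      Integrable.of_bound (K.measurable_coe hB).ennreal_toReal.aestronglyMeasurable 1
        (ae_of_all _ fun u => by
          rw [Real.norm_eq_abs, abs_of_nonneg ENNReal.toReal_nonneg]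
          exact measureReal_le_one (μ := K u) (s := B))
    have hreal : ∀ u, ENNReal.ofReal c • Q u ≤ P u → ∀ A, c * (Q u A).toReal ≤ (P u A).toReal := by
      intro u hu A
      have := ENNReal.toReal_mono (measure_ne_top _ _) (hu A)
      simpa [ENNReal.toReal_ofReal hc] using this
    have hrange : ∀ u, ENNReal.ofReal c • Q u ≤ P u →
        (P u B).toReal - c * (Q u B).toReal ∈ Icc 0 (1 - c) := by
      intro u hu
      have h1 := hreal u hu B
      have h2 := hreal u hu Bᶜ
      have p1 := probReal_compl_eq_one_sub (μ := P u) hB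
      have q1 := probReal_compl_eq_one_sub (μ := Q u) hB
      simp only [measureReal_def] at p1 q1
      rw [p1, q1] at h2
      constructor <;> linarith
    have hmain := aux_integral_tv (η x) (f := fun u => (P u B).toReal - c * (Q u B).toReal)
      (mP.sub (mQ.const_mul c)) (sub_nonneg.2 hc1) (hx.mono hrange) (hdom.mono hrange)
    rw [integral_sub (iK P _) ((iK Q _).const_mul c), integral_sub (iK P _) ((iK Q _).const_mul c),
      integral_const_mul, integral_const_mul, ← aux_integral_unif hP hB,
      ← aux_integral_unif hQ hB, ← aux_integral_apply x hB] at hmain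
    have hq : |∫ u, (Q u B).toReal ∂(η x) - (unif01 B).toReal| ≤ ∫ u, auxTV (Q u) ∂(η x) := by
      have : ∫ u, (Q u B).toReal ∂(η x) - (unif01 B).toReal
          = ∫ u, ((Q u B).toReal - (unif01 B).toReal) ∂(η x) := by
        rw [integral_sub (iK Q _) (integrable_const _)]; simp
      rw [this]
      refine abs_integral_le_integral_abs.trans (integral_mono
        (((iK Q _).sub (integrable_const _)).abs) (aux_tv_integrable Q _) fun u => ?_)
      exact aux_le_tv (Q u) hB
    have hq' := mul_le_mul_of_nonneg_left hq hc
    rw [← abs_of_nonneg hc, ← abs_mul, abs_of_nonneg hc] at hq'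
    rw [abs_le] at *
    constructor <;> linarith
  have i1 : Integrable (fun x => ∫ u, auxTV (Q u) ∂(η x)) unif01 := by
    refine Integrable.of_bound
      ((aux_tv_measurable Q).stronglyMeasurable.integral_kernel).aestronglyMeasurable 1
      (ae_of_all _ fun x => ?_)
    refine (norm_integral_le_of_norm_le_const (C := 1) (ae_of_all _ fun u => ?_)).trans (by simp)
    rw [Real.norm_eq_abs, abs_of_nonneg (aux_tv_nonneg _)]; exact aux_tv_le_one _
  have := integral_mono_ae (aux_tv_integrable (P ∘ₖ η) unif01)
    ((i1.const_mul c).add ((aux_tv_integrable η unif01).const_mul (1 - c))) key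
  simp only [Pi.add_apply] at this
  rw [integral_add (i1.const_mul c) ((aux_tv_integrable η unif01).const_mul (1 - c)),
    integral_const_mul, integral_const_mul, aux_integral_inv hη (aux_tv_integrable Q unif01)] at this
  exact this

lemma aux_beta_nonneg (η : Kernel ℝ ℝ) : 0 ≤ betaKernel η :=
  integral_nonneg fun x => aux_tv_nonneg (η x)

lemma aux_beta_le_one (η : Kernel ℝ ℝ) [IsMarkovKernel η] : betaKernel η ≤ 1 := by
  have := integral_mono (aux_tv_integrable η unif01) (integrable_const (1:ℝ))
    fun x => aux_tv_le_one (η x)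
  simp only [integral_const, probReal_univ, smul_eq_mul, mul_one] at this
  exact this

/-- The numerical recursion argument. -/
lemma aux_recursion {b q : ℕ → ℝ} {a : ℝ} (ha : 0 < a) (ha1 : a ≤ 1) (hb0 : ∀ n, 0 ≤ b n)
    (hb1 : ∀ n, b n ≤ 1) (hq : Tendsto q atTop (nhds 0))
    (h : ∀ n m, b (n + m) ≤ a ^ m * q m + (1 - a ^ m) * b n) : Tendsto b atTop (nhds 0) := by
  have hbdd : IsBoundedUnder (· ≤ ·) atTop b := isBoundedUnder_of ⟨1, hb1⟩
  have hcob : IsCoboundedUnder (· ≤ ·) atTop b :=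
    (isBoundedUnder_of ⟨0, hb0⟩ : IsBoundedUnder (· ≥ ·) atTop b).isCoboundedUnder_le
  have hL : ∀ m, limsup b atTop ≤ q m := by
    intro m
    have hpos : 0 < a ^ m := pow_pos ha m
    have hle : a ^ m ≤ 1 := pow_le_one₀ ha.le ha1
    by_contra! hlt
    -- eventually b n ≤ L + ε
    set L := limsup b atTop with hLdef
    set ε := a ^ m * (L - q m) / 2 with hε
    have hεpos : 0 < ε := by
      have := mul_pos hpos (sub_pos.2 hlt)
      linarith
    have hev : ∀ᶠ n in atTop, b n < L + ε :=
      eventually_lt_of_limsup_lt (by linarith) hbdd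
    have hev2 : ∀ᶠ n in atTop, b n ≤ L - ε := by
      rw [eventually_atTop] at hev ⊢
      obtain ⟨n₀, hn₀⟩ := hev
      refine ⟨n₀ + m, fun k hk => ?_⟩
      obtain ⟨n, rfl⟩ : ∃ n, k = n + m := ⟨k - m, by omega⟩
      have hn := hn₀ n (by omega)
      have h1 := h n m
      have h2 := mul_le_mul_of_nonneg_left hn.le (sub_nonneg.2 hle)
      nlinarith
    have := limsup_le_of_le hcob hev2
    linarith
  have hL0 : limsup b atTop ≤ 0 := ge_of_tendsto' hq hL
  refine tendsto_of_le_liminf_of_limsup_le ?_ hL0 hbdd (isBoundedUnder_of ⟨0, hb0⟩)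
  exact le_liminf_of_le hbdd.isCoboundedUnder_ge (Eventually.of_forall hb0)

/-- A convex combination of copulas inherits absolute regularity from any of its components
with positive weight; moreover the `m`-step transition kernel of the combination dominates
`aⱼᵐ` times the `m`-step kernel generated by `Cⱼ`. -/
theorem convex_combination_absolutely_regular (N : ℕ) (C : Fin N → ℝ → ℝ → ℝ)
    (hC : ∀ k, IsCopula (C k)) (a : Fin N → ℝ) (ha : ∀ k, 0 ≤ a k)
    (hsum : ∑ k, a k = 1) (j : Fin N) (haj : 0 < a j)
    (κj : Kernel ℝ ℝ) [IsMarkovKernel κj] (hκj : IsCopulaKernel (C j) κj)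
    (hreg : Tendsto (fun n => betaKernel (kpow κj n)) atTop (nhds 0))
    (κ : Kernel ℝ ℝ) [IsMarkovKernel κ]
    (hκ : IsCopulaKernel (fun x y => ∑ k, a k * C k x y) κ) :
    Tendsto (fun n => betaKernel (kpow κ n)) atTop (nhds 0) ∧
    ∀ m : ℕ, 1 ≤ m → ∀ᵐ x ∂unif01, ∀ A : Set ℝ, MeasurableSet A → A ⊆ Icc (0:ℝ) 1 →
      ENNReal.ofReal ((a j) ^ m) * kpow κj m x A ≤ kpow κ m x A := by
  have hP := aux_invariant (aux_copula_comb hC ha hsum) hκ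
  have hQ := aux_invariant (hC j) hκj
  have hdom := aux_dom_pow (ha j) hQ (aux_dom_one hC ha hsum j κj hκj κ hκ)
  have ha1 : a j ≤ 1 := by
    rw [← hsum]
    exact Finset.single_le_sum (fun k _ => ha k) (Finset.mem_univ j)
  constructor
  · refine aux_recursion haj ha1 (fun n => aux_beta_nonneg _) (fun n => aux_beta_le_one _) hreg
      fun n m => ?_
    rw [aux_kpow_add]
    exact aux_step (pow_nonneg haj.le m) (pow_le_one₀ haj.le ha1) (aux_kpow_inv hP n)
      (aux_kpow_inv hP m) (aux_kpow_inv hQ m) (hdom m)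
  · intro m _
    filter_upwards [hdom m] with x hx A _ _
    simpa using hx A
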